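/- On the hyperplane ζ₁ + ζ₂ + ζ₃ = 0 in (ℝ²)³, with ζ_j = (ξ_j, η_j), suppose |ζ₃| ≪ |ζ₁| (say |ζ₃| ≤ c|ζ₁| for small c). Then the symbol M₁ = ξ₁|ζ₁|² + ξ₂|ζ₂|² + ξ₃|ζ₃|² satisfies |M₁| ≲ |ξ₁||ζ₁||ζ₃| + |ξ₃||ζ₂|² ≲ |ζ₁|²|ζ₃|. -/

import Mathlib

/-- On the hyperplane `ζ₁ + ζ₂ + ζ₃ = 0` in `(ℝ²)³`, with `ζⱼ = (ξⱼ, ηⱼ)` and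
`|ζ₃| ≪ |ζ₁|` (i.e. `|ζ₃| ≤ c|ζ₁|` for a small constant `c`), the symbol
`M₁ = ξ₁|ζ₁|² + ξ₂|ζ₂|² + ξ₃|ζ₃|²` satisfies
`|M₁| ≲ |ξ₁||ζ₁||ζ₃| + |ξ₃||ζ₂|² ≲ |ζ₁|²|ζ₃|`. -/
theorem symbol_M1_mean_value_bound :
    ∃ c : ℝ, 0 < c ∧ ∃ C : ℝ, 0 < C ∧
      ∀ ζ₁ ζ₂ ζ₃ : EuclideanSpace ℝ (Fin 2),
        ζ₁ + ζ₂ + ζ₃ = 0 → ‖ζ₃‖ ≤ c * ‖ζ₁‖ →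
        |ζ₁ 0 * ‖ζ₁‖ ^ 2 + ζ₂ 0 * ‖ζ₂‖ ^ 2 + ζ₃ 0 * ‖ζ₃‖ ^ 2| ≤
            C * (|ζ₁ 0| * ‖ζ₁‖ * ‖ζ₃‖ + |ζ₃ 0| * ‖ζ₂‖ ^ 2) ∧
          |ζ₁ 0| * ‖ζ₁‖ * ‖ζ₃‖ + |ζ₃ 0| * ‖ζ₂‖ ^ 2 ≤ C * (‖ζ₁‖ ^ 2 * ‖ζ₃‖) := by
  refine ⟨1 / 2, by norm_num, 13 / 4, by norm_num, fun ζ₁ ζ₂ ζ₃ hsum hsmall => ?_⟩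
  have h₂ : ζ₂ = -(ζ₁ + ζ₃) := by
    rw [eq_neg_iff_add_eq_zero, ← hsum]
    abel
  have hξ₂ : ζ₂ 0 = -(ζ₁ 0 + ζ₃ 0) := by simp [h₂]
  have hξ₁ : |ζ₁ 0| ≤ ‖ζ₁‖ := PiLp.norm_apply_le ζ₁ 0
  have hξ₃ : |ζ₃ 0| ≤ ‖ζ₃‖ := PiLp.norm_apply_le ζ₃ 0
  have hnorm : ‖ζ₂‖ = ‖ζ₁ + ζ₃‖ := by rw [h₂, norm_neg]
  have hupper : ‖ζ₂‖ ≤ ‖ζ₁‖ + ‖ζ₃‖ := hnorm ▸ norm_add_le ζ₁ ζ₃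
  have hlower : ‖ζ₁‖ ≤ ‖ζ₂‖ + ‖ζ₃‖ := by
    have := norm_sub_le (ζ₁ + ζ₃) ζ₃
    rwa [add_sub_cancel_right, ← hnorm] at this
  have hn₁ := norm_nonneg ζ₁
  have hn₂ := norm_nonneg ζ₂
  have hn₃ := norm_nonneg ζ₃
  generalize ‖ζ₁‖ = a at *
  generalize ‖ζ₂‖ = b at *
  generalize ‖ζ₃‖ = d at *
  have hb : b ^ 2 ≤ 9 / 4 * a ^ 2 := by nlinarith
  constructor
  · have hdiff₁ : |a ^ 2 - b ^ 2| ≤ 13 / 4 * (a * d) := by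
      rw [abs_le]
      constructor <;> nlinarith [mul_nonneg hn₁ hn₃, mul_nonneg hn₂ hn₃]
    have hdiff₃ : |d ^ 2 - b ^ 2| ≤ 13 / 4 * b ^ 2 := by
      rw [abs_le]
      constructor <;> nlinarith
    calc |ζ₁ 0 * a ^ 2 + ζ₂ 0 * b ^ 2 + ζ₃ 0 * d ^ 2|
        = |ζ₁ 0 * (a ^ 2 - b ^ 2) + ζ₃ 0 * (d ^ 2 - b ^ 2)| := by
          rw [hξ₂]
          ring_nf
      _ ≤ |ζ₁ 0| * |a ^ 2 - b ^ 2| + |ζ₃ 0| * |d ^ 2 - b ^ 2| := by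
          rw [← abs_mul, ← abs_mul]
          exact abs_add_le _ _
      _ ≤ |ζ₁ 0| * (13 / 4 * (a * d)) + |ζ₃ 0| * (13 / 4 * b ^ 2) := by gcongr
      _ = 13 / 4 * (|ζ₁ 0| * a * d + |ζ₃ 0| * b ^ 2) := by ring
  · calc |ζ₁ 0| * a * d + |ζ₃ 0| * b ^ 2
        ≤ a * a * d + d * (9 / 4 * a ^ 2) := by gcongr
      _ = 13 / 4 * (a ^ 2 * d) := by ring
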